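/- Under the same hypotheses as the support lemma (Q₀ > 1, q∞ ∈ (Q₀^{−1}, Q₀), 0 < c ≤ mQ₀, Ψ̊_ε(x) = Γ((x − q∞e₂)/ε) − Γ((x + q∞e₂)/ε), and Ω = m + (m·log(2q∞) − c·q∞)/|log ε|, which is exactly the choice making −Γ(2q∞e₂/ε) − c q∞ − |log ε|·Ω = 0), the following mass estimate holds: M − ε^{−2}∫_{ℝ²} (Ψ̊_ε(x) − c x₂ − |log ε|·Ω)₊^γ · 1_{B_s(q∞e₂)}(x) dx = O(ε) as ε → 0. -/

import Mathlib

open MeasureTheory Metric Real Filter Topology Set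
open scoped ENNReal

noncomputable section

/-- The plane `ℝ²`. -/
abbrev E2 : Type := EuclideanSpace ℝ (Fin 2)

/-- First standard basis vector. -/
def e1 : E2 := EuclideanSpace.single 0 1

/-- Second standard basis vector. -/
def e2 : E2 := EuclideanSpace.single 1 1

/-- Partial derivative in direction `i`. -/
def pdv (i : Fin 2) (f : E2 → ℝ) (x : E2) : ℝ := fderiv ℝ f x (EuclideanSpace.single i 1)

/-- The Laplacian `Δf = ∂₁₁ f + ∂₂₂ f`. -/
def lap (f : E2 → ℝ) (x : E2) : ℝ := pdv 0 (pdv 0 f) x + pdv 1 (pdv 1 f) x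

theorem abs_max_rpow_sub_le {γ B a b : ℝ} (hγ : 1 ≤ γ) (ha : |a| ≤ B) (hb : |b| ≤ B) :
    |(max a 0) ^ γ - (max b 0) ^ γ| ≤ γ * B ^ (γ - 1) * |a - b| := by
  have hB : 0 ≤ B := (abs_nonneg a).trans ha
  have hmem : ∀ t : ℝ, |t| ≤ B → max t 0 ∈ Icc (0 : ℝ) B := fun t ht =>
    ⟨le_max_right _ _, max_le ((le_abs_self t).trans ht) hB⟩
  have hmv := (convex_Icc (0 : ℝ) B).norm_image_sub_le_of_norm_hasDerivWithin_le
    (f := fun t : ℝ => t ^ γ) (f' := fun t => γ * t ^ (γ - 1)) (C := γ * B ^ (γ - 1))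
    (fun t _ => (Real.hasDerivAt_rpow_const (Or.inr hγ)).hasDerivWithinAt)
    (fun t ht => by
      have h0 : 0 ≤ γ * t ^ (γ - 1) := mul_nonneg (by linarith) (Real.rpow_nonneg ht.1 _)
      rw [Real.norm_eq_abs, abs_of_nonneg h0]
      exact mul_le_mul_of_nonneg_left (Real.rpow_le_rpow ht.1 ht.2 (by linarith)) (by linarith))
    (hmem b hb) (hmem a ha)
  refine hmv.trans (mul_le_mul_of_nonneg_left ?_ ?_)
  · exact abs_max_sub_max_le_abs a b 0
  · exact mul_nonneg (by linarith) (Real.rpow_nonneg hB _)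

theorem abs_log_le_two_mul {w : ℝ} (hw : 1 / 2 ≤ w) : |Real.log w| ≤ 2 * |w - 1| := by
  have hw0 : 0 < w := by linarith
  have h1 := Real.log_le_sub_one_of_pos hw0
  have h2 := Real.one_sub_inv_le_log_of_pos hw0
  have h3 : 1 - w⁻¹ = w⁻¹ * (w - 1) := by field_simp
  have h4 : w⁻¹ ≤ 2 := by
    rw [inv_le_comm₀ hw0 two_pos]; linarith
  have h5 : |w⁻¹ * (w - 1)| ≤ 2 * |w - 1| := by
    rw [abs_mul, abs_of_pos (inv_pos.2 hw0)]
    exact mul_le_mul_of_nonneg_right h4 (abs_nonneg _)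
  rw [abs_le]
  constructor
  · linarith [neg_abs_le (w⁻¹ * (w - 1))]
  · linarith [le_abs_self (w - 1), abs_nonneg (w - 1)]

theorem norm_smul_e2 {t : ℝ} (ht : 0 ≤ t) : ‖t • e2‖ = t := by
  simp [e2, norm_smul, abs_of_nonneg ht]

/-- The vortex-pair stream function in the variable `y = (x - q e₂) / ε`, with the flux constant
subtracted. -/
def rescaledStream (Γ : E2 → ℝ) (m q c ε : ℝ) (y : E2) : ℝ :=
  Γ y - Γ (y + (2 * q / ε) • e2) - c * ε * y 1 - m * |Real.log ε| - m * Real.log (2 * q)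

theorem continuous_rescaledStream {Γ : E2 → ℝ} (hΓ : Continuous Γ) (m q c ε : ℝ) :
    Continuous (rescaledStream Γ m q c ε) := by
  unfold rescaledStream
  fun_prop

theorem stream_eq_rescaledStream (Γ : E2 → ℝ) (m q c : ℝ) {ε : ℝ} (hε : 0 < ε) (hε1 : ε < 1)
    (y : E2) :
    Γ (ε⁻¹ • ((ε • y + q • e2) - q • e2)) - Γ (ε⁻¹ • ((ε • y + q • e2) + q • e2))
        - c * (ε • y + q • e2 : E2) 1
        - |Real.log ε| * (m + (m * Real.log (2 * q) - c * q) / |Real.log ε|)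
      = rescaledStream Γ m q c ε y := by
  have hl : |Real.log ε| ≠ 0 := abs_ne_zero.2 (Real.log_neg hε hε1).ne
  have h1 : ε⁻¹ • ((ε • y + q • e2) - q • e2) = y := by
    rw [add_sub_cancel_right, smul_smul, inv_mul_cancel₀ hε.ne', one_smul]
  have h2 : ε⁻¹ • ((ε • y + q • e2) + q • e2) = y + (2 * q / ε) • e2 := by
    rw [add_assoc, ← add_smul, smul_add, smul_smul, smul_smul, inv_mul_cancel₀ hε.ne', one_smul]
    congr 2
    ring
  have h3 : (ε • y + q • e2 : E2) 1 = ε * y 1 + q := by simp [e2]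
  rw [h1, h2, h3, mul_add |Real.log ε|, mul_div_cancel₀ _ hl, rescaledStream]
  ring

theorem rescaledStream_eq_log {Γ : E2 → ℝ} {m q ε : ℝ} (c : ℝ) (hq : 0 < q) (hε : 0 < ε)
    (hε1 : ε < 1) (hΓlog : ∀ x : E2, 1 < ‖x‖ → Γ x = -m * Real.log ‖x‖) {y : E2}
    (hy : 1 < ‖y + (2 * q / ε) • e2‖) :
    rescaledStream Γ m q c ε y
      = Γ y + m * Real.log (‖y + (2 * q / ε) • e2‖ * ε / (2 * q)) - c * ε * y 1 := by
  have hz : (0 : ℝ) < ‖y + (2 * q / ε) • e2‖ := by linarith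
  rw [rescaledStream, hΓlog _ hy, abs_of_neg (Real.log_neg hε hε1),
    Real.log_div (by positivity) (by positivity), Real.log_mul hz.ne' hε.ne']
  ring

theorem abs_rescaledStream_sub_le {Γ : E2 → ℝ} {m q c ε K c₀ : ℝ} (hm : 0 < m) (hq : 0 < q)
    (hε : 0 < ε) (hε1 : ε < 1) (hεq : ε < q) (hK : K * ε ≤ q) (hc : 0 ≤ c) (hc₀ : c ≤ c₀)
    (hΓlog : ∀ x : E2, 1 < ‖x‖ → Γ x = -m * Real.log ‖x‖) {y : E2} (hy : ‖y‖ ≤ K) :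
    |rescaledStream Γ m q c ε y - Γ y| ≤ (m * K / q + c₀ * K) * ε := by
  have hn : ‖(2 * q / ε) • e2‖ = 2 * q / ε := norm_smul_e2 (by positivity)
  set z := y + (2 * q / ε) • e2 with hz
  have hdiff : |‖z‖ - 2 * q / ε| ≤ K := by
    rw [← hn]
    refine (abs_norm_sub_norm_le _ _).trans ?_
    simpa [hz] using hy
  have hw : |‖z‖ * ε / (2 * q) - 1| ≤ K * ε / (2 * q) := by
    have h : ‖z‖ * ε / (2 * q) - 1 = (‖z‖ - 2 * q / ε) * (ε / (2 * q)) := by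
      field_simp
    rw [h, abs_mul, abs_of_pos (by positivity : 0 < ε / (2 * q)), mul_div_assoc K]
    exact mul_le_mul_of_nonneg_right hdiff (by positivity)
  have hw2 : K * ε / (2 * q) ≤ 1 / 2 := by
    rw [div_le_iff₀ (by positivity)]; linarith
  have hhalf : 1 / 2 ≤ ‖z‖ * ε / (2 * q) := by linarith [(abs_le.1 hw).1]
  have hz1 : 1 < ‖z‖ := by
    have h := (le_div_iff₀ (by positivity)).1 hhalf
    nlinarith [norm_nonneg z]
  have hlog := (abs_log_le_two_mul hhalf).trans (mul_le_mul_of_nonneg_left hw two_pos.le)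
  have hc₀0 : 0 ≤ c₀ := hc.trans hc₀
  have hy1 : |y 1| ≤ K := (PiLp.norm_apply_le y 1).trans hy
  rw [rescaledStream_eq_log c hq hε hε1 hΓlog hz1]
  calc |Γ y + m * Real.log (‖z‖ * ε / (2 * q)) - c * ε * y 1 - Γ y|
      = |m * Real.log (‖z‖ * ε / (2 * q)) - c * ε * y 1| := by congr 1; ring
    _ ≤ |m * Real.log (‖z‖ * ε / (2 * q))| + |c * ε * y 1| := abs_sub _ _
    _ = m * |Real.log (‖z‖ * ε / (2 * q))| + c * ε * |y 1| := by
      rw [abs_mul, abs_mul, abs_of_pos hm, abs_of_nonneg (by positivity : 0 ≤ c * ε)]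
    _ ≤ m * (2 * (K * ε / (2 * q))) + c₀ * ε * K := by gcongr
    _ = (m * K / q + c₀ * K) * ε := by field_simp

theorem rescaledStream_nonpos_of_far {Γ : E2 → ℝ} {m q c ε s Q A : ℝ} (hm : 0 < m) (hq : 0 < q)
    (hs : 0 < s) (hQ : 0 < Q) (hε : 0 < ε) (hε1 : ε < 1) (hεq : ε < q)
    (hεA : ε ≤ Real.exp (-((A + m * Q * s - m * Real.log q - m * Real.log (2 * q)) / (2 * m))))
    (hc : 0 ≤ c) (hcQ : c ≤ m * Q) (hA : ∀ z : E2, ‖z‖ ≤ 1 → |Γ z| ≤ A)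
    (hΓlog : ∀ x : E2, 1 < ‖x‖ → Γ x = -m * Real.log ‖x‖) {y : E2}
    (hy : (1 + s / (2 * q)) * Real.exp (Q * s) < ‖y‖) (hys : ‖y‖ * ε < s) :
    rescaledStream Γ m q c ε y ≤ 0 := by
  have hn : ‖(2 * q / ε) • e2‖ = 2 * q / ε := norm_smul_e2 (by positivity)
  have hr : 1 ≤ 1 + s / (2 * q) := by
    have : 0 < s / (2 * q) := by positivity
    linarith
  have hlogK : Real.log (1 + s / (2 * q)) + Q * s ≤ Real.log ‖y‖ := by
    nth_rw 1 [← Real.log_exp (Q * s)]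
    rw [← Real.log_mul (by positivity) (by positivity)]
    exact Real.log_le_log (by positivity) hy.le
  have hy1 : 1 < ‖y‖ := by
    have : 1 ≤ Real.exp (Q * s) := Real.one_le_exp (by positivity)
    nlinarith
  have hcy : -(c * ε * y 1) ≤ m * Q * s := by
    have h1 : |y 1| ≤ ‖y‖ := PiLp.norm_apply_le y 1
    calc -(c * ε * y 1) = c * ε * -(y 1) := by ring
      _ ≤ c * ε * ‖y‖ := by gcongr; exact (neg_le_abs _).trans h1
      _ = c * (‖y‖ * ε) := by ring
      _ ≤ m * Q * s := by gcongr
  have htri : 2 * q / ε ≤ ‖y + (2 * q / ε) • e2‖ + ‖y‖ := by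
    have := norm_sub_le (y + (2 * q / ε) • e2) y
    rwa [add_sub_cancel_left, hn] at this
  have htri' : ‖y + (2 * q / ε) • e2‖ ≤ ‖y‖ + 2 * q / ε := by
    have := norm_add_le y ((2 * q / ε) • e2)
    rwa [hn] at this
  rcases lt_or_ge 1 ‖y + (2 * q / ε) • e2‖ with hz | hz
  · rw [rescaledStream_eq_log c hq hε hε1 hΓlog hz, hΓlog y hy1]
    have h2 : ‖y + (2 * q / ε) • e2‖ * ε / (2 * q) ≤ 1 + s / (2 * q) := by
      have h3 : ‖y + (2 * q / ε) • e2‖ * ε ≤ ‖y‖ * ε + 2 * q := by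
        have := mul_le_mul_of_nonneg_right htri' hε.le
        rwa [add_mul, div_mul_cancel₀ _ hε.ne'] at this
      have h4 : 1 + s / (2 * q) = (2 * q + s) / (2 * q) := by field_simp
      rw [h4]
      gcongr
      linarith
    have h5 := Real.log_le_log (by positivity) h2
    nlinarith [mul_le_mul_of_nonneg_left h5 hm.le, mul_le_mul_of_nonneg_left hlogK hm.le]
  · have hyq : q / ε ≤ ‖y‖ := by
      have h1 : 1 ≤ q / ε := by rw [le_div_iff₀ hε]; linarith
      have h2 : 2 * q / ε = q / ε + q / ε := by ring
      linarith
    have h3 := Real.log_le_log (by positivity) hyq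
    rw [Real.log_div hq.ne' hε.ne'] at h3
    have h4 := Real.log_le_log hε hεA
    rw [Real.log_exp] at h4
    have h5 : m * Real.log ε * 2
        ≤ -(A + m * Q * s - m * Real.log q - m * Real.log (2 * q)) := by
      have h6 := mul_le_mul_of_nonneg_left h4 (by positivity : 0 ≤ 2 * m)
      have h7 : 2 * m * -((A + m * Q * s - m * Real.log q - m * Real.log (2 * q)) / (2 * m))
          = -(A + m * Q * s - m * Real.log q - m * Real.log (2 * q)) := by field_simp
      linarith
    have h8 := (abs_le.1 (hA _ hz)).1
    have h9 := mul_le_mul_of_nonneg_left h3 hm.le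
    rw [rescaledStream, hΓlog y hy1, abs_of_neg (Real.log_neg hε hε1)]
    linarith

theorem scaled_setIntegral_ball_eq (F : E2 → ℝ) (p : E2) (s : ℝ) {ε : ℝ} (hε : 0 < ε) :
    (ε ^ 2)⁻¹ * ∫ x in ball p s, F x = ∫ y in ball (0 : E2) (s / ε), F (ε • y + p) := by
  rw [← integral_indicator measurableSet_ball, ← integral_indicator measurableSet_ball,
    ← integral_add_right_eq_self _ p]
  have h := Measure.integral_comp_smul (volume : Measure E2)
    (fun x => (ball p s).indicator F (x + p)) ε
  rw [finrank_euclideanSpace_fin, abs_of_pos (by positivity), smul_eq_mul] at h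
  rw [← h]
  congr 1 with y
  have hmem : ε • y + p ∈ ball p s ↔ y ∈ ball (0 : E2) (s / ε) := by
    rw [mem_ball_iff_norm, add_sub_cancel_right, mem_ball_zero_iff, norm_smul, Real.norm_eq_abs,
      abs_of_pos hε, lt_div_iff₀ hε, mul_comm]
  by_cases hy : y ∈ ball (0 : E2) (s / ε)
  · rw [indicator_of_mem hy, indicator_of_mem (hmem.2 hy)]
  · rw [indicator_of_notMem hy, indicator_of_notMem (mt hmem.1 hy)]

/-- mass estimate: under the hypotheses of the support lemma, and with
`Ω = m + (m log(2q∞) − c q∞)/|log ε|` (the choice making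
`−Γ(2q∞e₂/ε) − c q∞ − |log ε|Ω = 0`),
`M − ε⁻²∫_{ℝ²}(Ψ̊_ε − c x₂ − |log ε|Ω)₊^γ 1_{B_s(q∞e₂)} dx = O(ε)` as `ε → 0`. -/
theorem statement_5 (γ m Q₀ s qinf : ℝ) (hγ : 3 < γ) (hm : 0 < m)
    (hQ₀ : 1 < Q₀) (hs : 0 < s) (hq : qinf ∈ Ioo Q₀⁻¹ Q₀)
    (Γ : E2 → ℝ)
    (hΓ1 : ContDiff ℝ 1 Γ)
    (hΓrad : ∀ x y : E2, ‖x‖ = ‖y‖ → Γ x = Γ y)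
    (hΓeq : ∀ x : E2, lap Γ x + (max (Γ x) 0) ^ γ = 0)
    (hΓpos : {x : E2 | 0 < Γ x} = ball (0 : E2) 1)
    (hΓlog : ∀ x : E2, 1 < ‖x‖ → Γ x = -m * Real.log ‖x‖)
    (c : ℝ → ℝ)
    (hc : ∃ ε₁ > 0, ∀ ε : ℝ, 0 < ε → ε < ε₁ → 0 < c ε ∧ c ε ≤ m * Q₀) :
    ∃ C > 0, ∃ ε₀ > 0, ∀ ε : ℝ, 0 < ε → ε < ε₀ →
      |(∫ x : E2, (max (Γ x) 0) ^ γ) -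
        (ε ^ 2)⁻¹ * ∫ x in ball ((qinf • e2 : E2)) s,
          (max (Γ (ε⁻¹ • (x - qinf • e2)) - Γ (ε⁻¹ • (x + qinf • e2)) - c ε * x 1
            - |Real.log ε| * (m + (m * Real.log (2 * qinf) - c ε * qinf) / |Real.log ε|))
            0) ^ γ|
      ≤ C * ε := by
  have hQ : 0 < Q₀ := by linarith
  have hq0 : 0 < qinf := (inv_pos.2 hQ).trans hq.1
  have hΓc : Continuous Γ := hΓ1.continuous
  obtain ⟨ε₁, hε₁, hc⟩ := hc
  set K : ℝ := (1 + s / (2 * qinf)) * Real.exp (Q₀ * s) with hKdef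
  have hK1 : 1 ≤ K := one_le_mul_of_one_le_of_one_le
    (le_add_of_nonneg_right (by positivity)) (Real.one_le_exp (by positivity))
  have hK0 : 0 < K := by linarith
  obtain ⟨A, hA⟩ := (isCompact_closedBall (0 : E2) K).exists_bound_of_continuousOn hΓc.continuousOn
  have hA' : ∀ y : E2, ‖y‖ ≤ K → |Γ y| ≤ A := fun y hy => hA y (mem_closedBall_zero_iff.2 hy)
  have hA0 : 0 ≤ A := (abs_nonneg _).trans (hA' 0 (by simpa using hK0.le))
  set C₁ : ℝ := m * K / qinf + m * Q₀ * K with hC₁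
  have hC₁0 : 0 < C₁ := by positivity
  set L : ℝ := γ * (A + C₁) ^ (γ - 1) with hL
  have hL0 : 0 < L := mul_pos (by linarith) (Real.rpow_pos_of_pos (by linarith) _)
  set V : ℝ := volume.real (closedBall (0 : E2) K) with hV
  set D : ℝ := Real.exp (-((A + m * Q₀ * s - m * Real.log qinf - m * Real.log (2 * qinf))
    / (2 * m))) with hD
  have hD0 : 0 < D := Real.exp_pos _
  refine ⟨L * C₁ * V + 1, by positivity,
    min (min ε₁ 1) (min (min (qinf / K) (s / K)) D), by positivity, ?_⟩
  intro ε hε hεlt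
  simp only [lt_min_iff] at hεlt
  obtain ⟨⟨hεε₁, hε1⟩, ⟨hεqK, hεsK⟩, hεD⟩ := hεlt
  obtain ⟨hc0, hcle⟩ := hc ε hε hεε₁
  have hKq : K * ε ≤ qinf := by rw [lt_div_iff₀ hK0] at hεqK; linarith
  have hKs : K < s / ε := by
    rw [lt_div_iff₀ hK0] at hεsK
    rw [lt_div_iff₀ hε]; linarith
  have hεq : ε < qinf := hεqK.trans_le (div_le_self hq0.le hK1)
  have hpow : Continuous fun t : ℝ => (max t 0) ^ γ :=
    (continuous_id.max continuous_const).rpow_const fun _ => Or.inr (by linarith)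
  have hzero : ∀ t : ℝ, t ≤ 0 → (max t 0) ^ γ = 0 := fun t ht => by
    rw [max_eq_right ht, Real.zero_rpow (by linarith)]
  set G : E2 → ℝ := rescaledStream Γ m qinf (c ε) ε with hG
  have hGc : Continuous G := continuous_rescaledStream hΓc _ _ _ _
  have hM : ∫ x : E2, (max (Γ x) 0) ^ γ = ∫ x in closedBall (0 : E2) K, (max (Γ x) 0) ^ γ := by
    refine (setIntegral_eq_integral_of_forall_compl_eq_zero fun x hx => hzero _ ?_).symm
    by_contra! hpos
    have hx1 : x ∈ ball (0 : E2) 1 := hΓpos ▸ hpos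
    exact hx (ball_subset_closedBall (ball_subset_ball hK1 hx1))
  have hI : (ε ^ 2)⁻¹ * ∫ x in ball ((qinf • e2 : E2)) s,
          (max (Γ (ε⁻¹ • (x - qinf • e2)) - Γ (ε⁻¹ • (x + qinf • e2)) - c ε * x 1
            - |Real.log ε| * (m + (m * Real.log (2 * qinf) - c ε * qinf) / |Real.log ε|))
            0) ^ γ = ∫ y in closedBall (0 : E2) K, (max (G y) 0) ^ γ := by
    rw [scaled_setIntegral_ball_eq _ _ _ hε]
    simp only [stream_eq_rescaledStream Γ m qinf (c ε) hε hε1]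
    refine setIntegral_eq_of_subset_of_forall_sdiff_eq_zero measurableSet_ball
      (closedBall_subset_ball hKs) fun y hy => hzero _ ?_
    obtain ⟨hys, hyK⟩ := hy
    rw [mem_ball_zero_iff, lt_div_iff₀ hε] at hys
    rw [mem_closedBall_zero_iff, not_le] at hyK
    exact rescaledStream_nonpos_of_far hm hq0 hs hQ hε hε1 hεq hεD.le hc0.le hcle
      (fun z hz => hA' z (hz.trans hK1)) hΓlog hyK hys
  have hcomp := isCompact_closedBall (0 : E2) K
  have hintegrable : ∀ g : E2 → ℝ, Continuous g →
      IntegrableOn (fun y => (max (g y) 0) ^ γ) (closedBall 0 K) := fun g hg =>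
    (hpow.comp hg).continuousOn.integrableOn_compact hcomp
  rw [hM, hI, ← integral_sub (hintegrable Γ hΓc) (hintegrable G hGc)]
  have hbound : ∀ y ∈ closedBall (0 : E2) K,
      ‖(max (Γ y) 0) ^ γ - (max (G y) 0) ^ γ‖ ≤ L * (C₁ * ε) := by
    intro y hy
    rw [mem_closedBall_zero_iff] at hy
    have h1 : |G y - Γ y| ≤ C₁ * ε :=
      abs_rescaledStream_sub_le hm hq0 hε hε1 hεq hKq hc0.le hcle hΓlog hy
    have h2 := hA' y hy
    have h3 : |G y| ≤ A + C₁ := by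
      have h4 : |G y| ≤ |G y - Γ y| + |Γ y| := by
        simpa using abs_add_le (G y - Γ y) (Γ y)
      nlinarith
    refine (abs_max_rpow_sub_le (by linarith) (by linarith) h3).trans ?_
    rw [abs_sub_comm]
    exact mul_le_mul_of_nonneg_left h1 hL0.le
  have hfin := norm_setIntegral_le_of_norm_le_const (μ := volume) hcomp.measure_lt_top hbound
  rw [Real.norm_eq_abs] at hfin
  refine hfin.trans ?_
  have : L * (C₁ * ε) * volume.real (closedBall (0 : E2) K) = L * C₁ * V * ε := by
    rw [hV]; ring
  rw [this]
  linarith
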